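/- Fix H > 0, B > 1, and a, b > 0 with a² ≤ b². Let x(r) = (1/H)·√(1 + B² + 2B·sin(Hr + 3π/2)), z(r) = ∫_{3π/(2H)}^{r + 3π/(2H)} (1 + B·sin(Ht))/√(1 + B² + 2B·sin(Ht)) dt, r₀ = (1/H)·arcsin(−1/B) + π/(2H), and ρ(r) = x(r) − (x'(r)/z'(r))·z(r)·(b²/a²) on (−r₀, r₀). Then there exists r̄ ∈ (0, r₀) such that ρ(r̄) = 0 and ρ(−r̄) = 0, and a²x(r)² + b²z(r)² ≤ a²x(r̄)² + b²z(r̄)² for all r ∈ [−r̄, r̄]. -/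

import Mathlib

open Real

/-- Kenmotsu's profile function `x(s) = (1/H)√(1 + B² + 2B sin(Hs + 3π/2))`. -/
noncomputable def kenX (H B : ℝ) (s : ℝ) : ℝ :=
  (1 / H) * Real.sqrt (1 + B ^ 2 + 2 * B * Real.sin (H * s + 3 * Real.pi / 2))

/-- Kenmotsu's height function
`z(s) = ∫_{3π/(2H)}^{s + 3π/(2H)} (1 + B sin(Ht))/√(1 + B² + 2B sin(Ht)) dt`. -/
noncomputable def kenZ (H B : ℝ) (s : ℝ) : ℝ :=
  ∫ t in (3 * Real.pi / (2 * H))..(s + 3 * Real.pi / (2 * H)),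
    (1 + B * Real.sin (H * t)) / Real.sqrt (1 + B ^ 2 + 2 * B * Real.sin (H * t))

/-- The function `ρ` of the Kenmotsu nodoid. -/
noncomputable def kenRho (H B a b : ℝ) (r : ℝ) : ℝ :=
  kenX H B r - (deriv (kenX H B) r / deriv (kenZ H B) r) * kenZ H B r *
    (b ^ 2 / a ^ 2)

lemma sin_add_three_pi_div_two (x : ℝ) : Real.sin (x + 3 * Real.pi / 2) = -Real.cos x := by
  rw [show x + 3 * Real.pi / 2 = x + Real.pi / 2 + Real.pi by ring, Real.sin_add_pi,
    Real.sin_add_pi_div_two]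

lemma radicand_pos {B : ℝ} (hB : 1 < B) (t : ℝ) : 0 < 1 + B ^ 2 - 2 * B * Real.cos t := by
  nlinarith [Real.cos_le_one t, sq_pos_of_pos (sub_pos.2 hB)]

lemma kenX_eq (H B s : ℝ) :
    kenX H B s = (1 / H) * √(1 + B ^ 2 - 2 * B * Real.cos (H * s)) := by
  rw [kenX, sin_add_three_pi_div_two]
  congr 2
  ring

/-- The integrand of `kenZ` after shifting the variable by `3π/(2H)`. -/
noncomputable def kenSlope (H B t : ℝ) : ℝ :=
  (1 - B * Real.cos (H * t)) / √(1 + B ^ 2 - 2 * B * Real.cos (H * t))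

lemma kenZ_eq {H : ℝ} (hH : 0 < H) (B s : ℝ) :
    kenZ H B s = ∫ t in (0 : ℝ)..s, kenSlope H B t := by
  have h := intervalIntegral.integral_comp_add_right (a := 0) (b := s)
    (fun t => (1 + B * Real.sin (H * t)) / √(1 + B ^ 2 + 2 * B * Real.sin (H * t)))
    (3 * Real.pi / (2 * H))
  rw [zero_add] at h
  rw [kenZ, ← h]
  refine intervalIntegral.integral_congr fun t _ => ?_
  have e : H * (t + 3 * Real.pi / (2 * H)) = H * t + 3 * Real.pi / 2 := by
    field_simp
  simp only [kenSlope, e, sin_add_three_pi_div_two]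
  congr 2 <;> ring

lemma continuous_kenSlope (H : ℝ) {B : ℝ} (hB : 1 < B) : Continuous (kenSlope H B) := by
  unfold kenSlope
  refine Continuous.div (by fun_prop) (by fun_prop) fun t => ?_
  exact (Real.sqrt_pos.2 (radicand_pos hB _)).ne'

lemma kenX_neg (H B s : ℝ) : kenX H B (-s) = kenX H B s := by
  simp [kenX_eq]

lemma kenZ_neg {H : ℝ} (hH : 0 < H) (B s : ℝ) : kenZ H B (-s) = -kenZ H B s := by
  have h := intervalIntegral.integral_comp_neg (a := 0) (b := s) (kenSlope H B)
  have e : ∀ t, kenSlope H B (-t) = kenSlope H B t := fun t => by simp [kenSlope]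
  simp only [e, neg_zero] at h
  rw [kenZ_eq hH, kenZ_eq hH, h, intervalIntegral.integral_symm]

lemma hasDerivAt_kenX {H B : ℝ} (hH : 0 < H) (hB : 1 < B) (s : ℝ) :
    HasDerivAt (kenX H B)
      (B * Real.sin (H * s) / √(1 + B ^ 2 - 2 * B * Real.cos (H * s))) s := by
  have h1 : HasDerivAt (fun s => H * s) H s := by simpa using (hasDerivAt_id s).const_mul H
  have h2 := ((((h1.cos.const_mul (2 * B)).const_sub (1 + B ^ 2)).sqrt
    (radicand_pos hB (H * s)).ne').const_mul (1 / H))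
  rw [show kenX H B = _ from funext (kenX_eq H B)]
  refine h2.congr_deriv ?_
  field_simp

lemma hasDerivAt_kenZ {H B : ℝ} (hH : 0 < H) (hB : 1 < B) (s : ℝ) :
    HasDerivAt (kenZ H B) (kenSlope H B s) s := by
  rw [show kenZ H B = _ from funext (kenZ_eq hH B)]
  exact (continuous_kenSlope H hB).integral_hasStrictDerivAt 0 s |>.hasDerivAt

lemma continuous_kenZ {H B : ℝ} (hH : 0 < H) (hB : 1 < B) : Continuous (kenZ H B) :=
  continuous_iff_continuousAt.2 fun s => (hasDerivAt_kenZ hH hB s).continuousAt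

lemma kenRho_eq {H B : ℝ} (hH : 0 < H) (hB : 1 < B) (a b r : ℝ) :
    kenRho H B a b r = kenX H B r -
      B * Real.sin (H * r) / (1 - B * Real.cos (H * r)) * kenZ H B r * (b ^ 2 / a ^ 2) := by
  rw [kenRho, (hasDerivAt_kenX hH hB r).deriv, (hasDerivAt_kenZ hH hB r).deriv, kenSlope,
    div_div_div_cancel_right₀ (Real.sqrt_pos.2 (radicand_pos hB _)).ne']

lemma kenRho_neg {H B : ℝ} (hH : 0 < H) (hB : 1 < B) (a b r : ℝ) :
    kenRho H B a b (-r) = kenRho H B a b r := by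
  simp only [kenRho_eq hH hB, kenX_neg, kenZ_neg hH, mul_neg, Real.sin_neg, Real.cos_neg, neg_div,
    neg_mul, neg_neg]

lemma kenX_monotoneOn {H B : ℝ} (hH : 0 < H) (hB : 1 < B) :
    MonotoneOn (kenX H B) (Set.Icc 0 (Real.pi / H)) := by
  intro s hs t ht hst
  rw [kenX_eq, kenX_eq]
  have hc : Real.cos (H * t) ≤ Real.cos (H * s) :=
    Real.cos_le_cos_of_nonneg_of_le_pi (mul_nonneg hH.le hs.1)
      (by have := (le_div_iff₀ hH).1 ht.2; linarith) (by gcongr)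
  gcongr

lemma kenZ_strictAntiOn {H B : ℝ} (hH : 0 < H) (hB : 1 < B) :
    StrictAntiOn (kenZ H B) (Set.Icc 0 (Real.arccos (1 / B) / H)) := by
  refine strictAntiOn_of_deriv_neg (convex_Icc _ _) (continuous_kenZ hH hB).continuousOn ?_
  intro t ht
  rw [interior_Icc] at ht
  rw [(hasDerivAt_kenZ hH hB t).deriv]
  have hlt : H * t < Real.arccos (1 / B) := by
    have := (lt_div_iff₀ hH).1 ht.2; linarith
  have hB0 : 0 < B := by linarith
  have hc := Real.cos_lt_cos_of_nonneg_of_le_pi (mul_nonneg hH.le ht.1.le)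
    (Real.arccos_le_pi _) hlt
  rw [Real.cos_arccos (by linarith [one_div_pos.2 hB0]) ((div_le_one hB0).2 hB.le),
    div_lt_iff₀' hB0] at hc
  exact div_neg_of_neg_of_pos (by linarith) (Real.sqrt_pos.2 (radicand_pos hB _))

/-- For the nodoid (`B > 1`) with `a² ≤ b²`: there is `r̄ ∈ (0, r₀)` with
`ρ(r̄) = ρ(-r̄) = 0` and `a²x(r)² + b²z(r)² ≤ a²x(r̄)² + b²z(r̄)²` for all
`r ∈ [-r̄, r̄]` (free boundary in a rotational ellipsoid), where
`r₀ = (1/H) arcsin(-1/B) + π/(2H)`. -/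
theorem nodoid_free_boundary_exists (H B a b : ℝ) (hH : 0 < H) (hB : 1 < B)
    (ha : 0 < a) (hb : 0 < b) (hab : a ^ 2 ≤ b ^ 2) :
    ∃ rb ∈ Set.Ioo (0 : ℝ) ((1 / H) * Real.arcsin (-(1 / B)) + Real.pi / (2 * H)),
      kenRho H B a b rb = 0 ∧ kenRho H B a b (-rb) = 0 ∧
      ∀ r ∈ Set.Icc (-rb) rb,
        a ^ 2 * (kenX H B r) ^ 2 + b ^ 2 * (kenZ H B r) ^ 2 ≤
          a ^ 2 * (kenX H B rb) ^ 2 + b ^ 2 * (kenZ H B rb) ^ 2 := by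
  have hB0 : 0 < B := by linarith
  have hr : (1 / H) * Real.arcsin (-(1 / B)) + Real.pi / (2 * H) = Real.arccos (1 / B) / H := by
    rw [Real.arcsin_neg, Real.arccos]
    field_simp
    ring
  rw [hr]
  set r₀ := Real.arccos (1 / B) / H with hr₀
  have hB1 : 1 / B < 1 := (div_lt_one hB0).2 hB
  have hθ : 0 < Real.arccos (1 / B) := Real.arccos_pos.2 hB1
  have hr0 : 0 < r₀ := div_pos hθ hH
  have hHr : H * r₀ = Real.arccos (1 / B) := by rw [hr₀]; field_simp
  have hcos : Real.cos (H * r₀) = 1 / B := by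
    rw [hHr, Real.cos_arccos (by linarith [one_div_pos.2 hB0]) hB1.le]
  have hsin : 0 < Real.sin (H * r₀) := by
    rw [hHr]
    refine Real.sin_pos_of_pos_of_lt_pi hθ ?_
    have := Real.arccos_lt_pi_div_two.2 (one_div_pos.2 hB0)
    linarith [Real.pi_pos]
  have hanti := kenZ_strictAntiOn hH hB
  have hmono := kenX_monotoneOn hH hB
  have hrπ : r₀ ≤ Real.pi / H := by rw [hr₀]; gcongr; exact Real.arccos_le_pi _
  have hz0 : kenZ H B 0 = 0 := by simp [kenZ]
  have hx : ∀ s, 0 < kenX H B s := fun s => by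
    rw [kenX_eq]
    exact mul_pos (one_div_pos.2 hH) (Real.sqrt_pos.2 (radicand_pos hB _))
  have hzr : kenZ H B r₀ < 0 := by
    rw [← hz0]
    exact hanti ⟨le_rfl, hr0.le⟩ ⟨hr0.le, le_rfl⟩ hr0
  have hk : 0 < b ^ 2 / a ^ 2 := by positivity
  have hcx : Continuous (kenX H B) :=
    continuous_iff_continuousAt.2 fun s => (hasDerivAt_kenX hH hB s).continuousAt
  have hcz := continuous_kenZ hH hB
  have hivt := intermediate_value_Ioo hr0.le
    (f := fun s => kenX H B s * (1 - B * Real.cos (H * s)) -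
      B * Real.sin (H * s) * kenZ H B s * (b ^ 2 / a ^ 2)) (by fun_prop)
  obtain ⟨s, hs, hs0⟩ := hivt (show (0 : ℝ) ∈ _ by
    constructor
    · have := mul_pos (hx 0) (sub_pos.2 hB)
      simp only [mul_zero, Real.cos_zero, Real.sin_zero, zero_mul, mul_one, sub_zero]
      linarith
    · have := mul_pos (mul_pos (mul_pos hB0 hsin) (neg_pos.2 hzr)) hk
      simp only [hcos, mul_one_div_cancel hB0.ne', sub_self, mul_zero]
      linarith)
  have hneg : 1 - B * Real.cos (H * s) < 0 := by
    have hlt : H * s < H * r₀ := by gcongr; exact hs.2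
    have hc := Real.cos_lt_cos_of_nonneg_of_le_pi (mul_nonneg hH.le hs.1.le)
      (hHr ▸ Real.arccos_le_pi _) hlt
    rw [hcos, div_lt_iff₀' hB0] at hc
    linarith
  have hρ : kenRho H B a b s = 0 := by
    rw [kenRho_eq hH hB]
    have h : kenX H B s * (1 - B * Real.cos (H * s)) =
      B * Real.sin (H * s) * kenZ H B s * (b ^ 2 / a ^ 2) := sub_eq_zero.1 hs0
    rw [eq_div_of_mul_eq hneg.ne h]
    ring
  refine ⟨s, hs, hρ, (kenRho_neg hH hB a b s).trans hρ, fun r hr => ?_⟩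
  have key : ∀ t, 0 ≤ t → t ≤ s → a ^ 2 * (kenX H B t) ^ 2 + b ^ 2 * (kenZ H B t) ^ 2 ≤
      a ^ 2 * (kenX H B s) ^ 2 + b ^ 2 * (kenZ H B s) ^ 2 := by
    intro t ht hts
    have h1 := hmono ⟨ht, (hts.trans hs.2.le).trans hrπ⟩ ⟨hs.1.le, hs.2.le.trans hrπ⟩ hts
    have h2 := hanti.antitoneOn ⟨ht, hts.trans hs.2.le⟩ ⟨hs.1.le, hs.2.le⟩ hts
    have h3 := hanti.antitoneOn ⟨le_rfl, hr0.le⟩ ⟨ht, hts.trans hs.2.le⟩ ht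
    rw [hz0] at h3
    have h4 : kenZ H B t ^ 2 ≤ kenZ H B s ^ 2 := by nlinarith
    have h5 := (hx t).le
    gcongr
  rcases le_total 0 r with h | h
  · exact key r h hr.2
  · have := key (-r) (neg_nonneg.2 h) (by linarith [hr.1])
    rwa [kenX_neg, kenZ_neg hH, neg_sq] at this
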